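/- arXiv:2508.15330 — 2 statements merged into one kernel-verified Lean document; each statement's English description precedes it below -/
import Mathlib

section
/- Let a, b, c, d be positive integers with a ≤ 5 and d ≤ 41. If b > 102 and c > 102, then (b+c+1)*(a*b*c+a*b*d+a*c*d+b*c*d+a*b+a*c+a*d+b*c+b*d+c*d+a+b+c+d+1) < b*(b+1)*c*(c+1) (i.e., inequality (vi) is not satisfied). -/
/-- Proposition 3.4: if a ≤ 5, d ≤ 41, b > 102 and c > 102
then inequality (vi) fails. -/
theorem yfrieze4_prop34
    (a b c d : ℕ) (ha : 0 < a) (hb : 0 < b) (hc : 0 < c) (hd : 0 < d)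
    (ha5 : a ≤ 5) (hd41 : d ≤ 41) (hb102 : b > 102) (hc102 : c > 102) :
    (b + c + 1) *
      (a * b * c + a * b * d + a * c * d + b * c * d + a * b + a * c + a * d +
        b * c + b * d + c * d + a + b + c + d + 1) <
      b * (b + 1) * c * (c + 1) := by
  have hle : a * b * c + a * b * d + a * c * d + b * c * d + a * b + a * c + a * d +
        b * c + b * d + c * d + a + b + c + d + 1 ≤
      47 * (b * c) + 252 * (b + c + 1) := by
    have had : (a + 1) * (d + 1) ≤ 252 :=
      Nat.mul_le_mul (by omega : a + 1 ≤ 6) (by omega : d + 1 ≤ 42)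
    calc _ = (a + d + 1) * (b * c) + (a + 1) * (d + 1) * (b + c + 1) := by ring
      _ ≤ _ := by gcongr; omega
  refine (Nat.mul_le_mul_left _ hle).trans_lt ?_
  obtain ⟨x, rfl⟩ := Nat.exists_eq_add_of_le (show 103 ≤ b from hb102)
  obtain ⟨y, rfl⟩ := Nat.exists_eq_add_of_le (show 103 ≤ c from hc102)
  zify
  rw [← sub_pos]
  ring_nf
  positivity
end

section
/- Positive integers (a,b,c,d,e,f,g,h,i,j,k,l,m,n) satisfy the ten diamond equations a*e = 1+b, b*f = (1+e)*(1+c), c*g = (1+f)*(1+d), d*h = 1+g, e*i = 1+f, f*j = (1+i)*(1+g), g*k = (1+j)*(1+h), i*l = 1+j, j*m = (1+l)*(1+k), l*n = 1+m if and only if the 14-tuple (a,b,c,d,e,f,g,h,i,j,k,l,m,n) is one of the following 42 tuples: (1,1,2,3,2,9,20,7,5,14,6,3,2,1), (1,1,4,5,2,15,24,5,8,15,4,2,1,1), (1,2,3,2,3,8,9,5,3,5,4,2,3,2), (1,2,3,4,3,8,15,4,3,8,3,3,2,1), (1,2,6,7,3,14,20,3,5,9,2,2,1,1), (1,2,9,5,3,20,14,3,7,6,2,1,1,2),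 (1,3,8,3,4,15,8,3,4,3,2,1,2,3), (1,4,5,3,5,9,8,3,2,3,2,2,3,2), (1,4,15,8,5,24,15,2,5,4,1,1,1,2), (1,6,14,5,7,20,9,2,3,2,1,1,2,3), (2,1,1,2,1,4,15,8,5,24,15,5,4,1), (2,1,2,3,1,6,14,5,7,20,9,3,2,1), (2,3,2,1,2,3,4,5,2,5,9,3,8,3), (2,3,2,3,2,3,8,3,2,9,5,5,4,1), (2,3,4,5,2,5,9,2,3,8,3,3,2,1), (2,3,8,3,2,9,5,2,5,4,3,1,2,3), (2,5,9,2,3,8,3,2,3,2,3,1,4,5), (2,9,5,2,5,4,3,2,1,2,3,3,8,3), (2,9,20,7,5,14,6,1,3,2,1,1,2,3), (2,15,24,5,8,15,4,1,2,1,1,1,4,5), (3,2,1,1,1,2,6,7,3,14,20,5,9,2), (3,2,1,2,1,2,9,5,3,20,14,7,6,1), (3,2,2,3,1,3,8,3,4,15,8,4,3,1), (3,2,3,2,1,4,5,3,5,9,8,2,3,2), (3,5,4,1,2,3,2,3,2,3,8,2,9,5), (3,8,3,1,3,2,2,3,1,3,8,4,15,4), (3,8,3,2,3,2,3,2,1,4,5,5,9,2),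 (3,8,9,5,3,5,4,1,2,3,2,2,3,2), (3,8,15,4,3,8,3,1,3,2,2,1,3,4), (3,14,20,3,5,9,2,1,2,1,2,1,6,7), (3,20,14,3,7,6,2,1,1,1,2,2,9,5), (4,3,2,1,1,2,3,4,3,8,15,3,8,3), (4,15,8,3,4,3,2,1,1,2,3,3,8,3), (5,4,1,1,1,1,4,5,2,15,24,8,15,2), (5,4,3,2,1,2,3,2,3,8,9,3,5,2), (5,9,2,1,2,1,2,3,1,6,14,7,20,3), (5,9,8,3,2,3,2,1,2,3,4,2,5,3), (5,14,6,1,3,2,1,2,1,2,9,3,20,7), (5,24,15,2,5,4,1,1,1,1,4,2,15,8), (7,6,2,1,1,1,2,3,2,9,20,5,14,3), (7,20,9,2,3,2,1,1,1,2,6,3,14,5), (8,15,4,1,2,1,1,2,1,4,15,5,24,5). -/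
/-- The first rows, over one full period of length seven, of the Y-frieze patterns of width 4. -/
def yfriezeFirstRows : List (ℕ × ℕ × ℕ × ℕ × ℕ × ℕ × ℕ) :=
  [(1, 2, 5, 3, 1, 3, 7), (1, 2, 8, 2, 1, 5, 5), (1, 3, 3, 2, 2, 2, 5),
   (1, 3, 3, 3, 1, 4, 4), (1, 3, 5, 2, 1, 7, 3), (1, 3, 7, 1, 2, 5, 3),
   (1, 4, 4, 1, 3, 3, 3), (1, 5, 2, 2, 2, 3, 3), (1, 5, 5, 1, 2, 8, 2),
   (1, 7, 3, 1, 3, 5, 2), (2, 1, 5, 5, 1, 2, 8), (2, 1, 7, 3, 1, 3, 5),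
   (2, 2, 2, 3, 3, 1, 5), (2, 2, 2, 5, 1, 3, 3), (2, 2, 3, 3, 1, 5, 2),
   (2, 2, 5, 1, 3, 3, 2), (2, 3, 3, 1, 5, 2, 2), (2, 5, 1, 3, 3, 2, 2),
   (2, 5, 3, 1, 3, 7, 1), (2, 8, 2, 1, 5, 5, 1), (3, 1, 3, 5, 2, 1, 7),
   (3, 1, 3, 7, 1, 2, 5), (3, 1, 4, 4, 1, 3, 3), (3, 1, 5, 2, 2, 2, 3),
   (3, 2, 2, 2, 5, 1, 3), (3, 3, 1, 4, 4, 1, 3), (3, 3, 1, 5, 2, 2, 2),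
   (3, 3, 2, 2, 2, 5, 1), (3, 3, 3, 1, 4, 4, 1), (3, 5, 2, 1, 7, 3, 1),
   (3, 7, 1, 2, 5, 3, 1), (4, 1, 3, 3, 3, 1, 4), (4, 4, 1, 3, 3, 3, 1),
   (5, 1, 2, 8, 2, 1, 5), (5, 1, 3, 3, 2, 2, 2), (5, 2, 1, 7, 3, 1, 3),
   (5, 2, 2, 2, 3, 3, 1), (5, 3, 1, 3, 7, 1, 2), (5, 5, 1, 2, 8, 2, 1),
   (7, 1, 2, 5, 3, 1, 3), (7, 3, 1, 3, 5, 2, 1), (8, 2, 1, 5, 5, 1, 2)]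

/-- The relation between five consecutive first-row entries `v, w, x, y, z`. -/
def FiveTermRel (v w x y z : ℕ) : Prop :=
  (v * w - 1) * (y * z - 1) * (1 + x) = (1 + w) * (1 + y) * z * v

instance (v w x y z : ℕ) : Decidable (FiveTermRel v w x y z) :=
  inferInstanceAs (Decidable (_ = _))

/-- The growth estimates for three consecutive first-row entries `v, w, x`. -/
def GrowthBound (v w x : ℕ) : Prop :=
  1 < v * w ∧ 1 < w * x ∧ (1 + x) * (v * w - 1) ≤ 4 * ((1 + w) * v) ∧
    (1 + v) * (w * x - 1) ≤ 4 * ((1 + w) * x)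

instance (v w x : ℕ) : Decidable (GrowthBound v w x) :=
  inferInstanceAs (Decidable (_ ∧ _ ∧ _ ∧ _))

/-- Glide symmetry: the diamond joining the end of the first row to the fourth row. -/
lemma glide_diamond {c d f g h i j k l m n : ℕ} (hg : 0 < g) (hj : 0 < j) (hl : 0 < l)
    (h₁ : c * g = (1 + f) * (1 + d)) (h₂ : d * h = 1 + g)
    (h₄ : f * j = (1 + i) * (1 + g)) (h₅ : g * k = (1 + j) * (1 + h))
    (h₆ : i * l = 1 + j) (h₇ : j * m = (1 + l) * (1 + k)) (h₈ : l * n = 1 + m) :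
    n * d = 1 + c := by
  have hpos : 0 < l * j * g := by positivity
  refine Nat.eq_of_mul_eq_mul_left hpos ?_
  zify at *
  linear_combination (j * g * d) * h₈ + (g * d) * h₇ + (1 + l) * d * h₅
    + (1 + l) * (1 + j) * h₂ - (j * l) * h₁ - l * (1 + d) * h₄
    - (1 + d) * (1 + g) * h₆

/-- The remaining second-row diamond, closing up the period. -/
lemma closing_diamond {a b c d e f g h i j k l m n : ℕ} (hd : 0 < d) (hg : 0 < g) (hj : 0 < j)
    (h₁ : c * g = (1 + f) * (1 + d)) (h₂ : d * h = 1 + g) (h₃ : e * i = 1 + f)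
    (h₄ : f * j = (1 + i) * (1 + g)) (h₆ : i * l = 1 + j) (h₇ : j * m = (1 + l) * (1 + k))
    (h₉ : n * d = 1 + c) (h₁₀ : h * a = 1 + k) (h₁₁ : a * e = 1 + b) :
    m * c = (1 + n) * (1 + b) := by
  have key : (1 + l) * h * i * (1 + d) = g * j * (1 + n) := by
    refine Nat.eq_of_mul_eq_mul_left hd ?_
    zify at *
    linear_combination (1 + l) * i * (1 + d) * h₂ - g * j * h₉ - j * h₁ - (1 + d) * h₄
      + (1 + d) * (1 + g) * h₆
  have hpos : 0 < g * j := by positivity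
  refine Nat.eq_of_mul_eq_mul_left hpos ?_
  rw [← h₁₁]
  rw [← h₁₀] at h₇
  rw [← h₃] at h₁
  zify at *
  linear_combination (c * g) * h₇ + (1 + l) * h * a * h₁ + a * e * key

lemma fiveTermRel_of_diamonds {v w x y z s t p q r u : ℕ} (hs : 0 < s) (ht : 0 < t)
    (h₁ : v * w = 1 + p) (h₂ : y * z = 1 + u)
    (h₃ : p * q = (1 + w) * (z * s)) (h₄ : q * r = (1 + x) * (s * t))
    (h₅ : r * u = (1 + y) * (t * v)) : FiveTermRel v w x y z := by
  have hp : v * w - 1 = p := by omega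
  have hu : y * z - 1 = u := by omega
  rw [FiveTermRel, hp, hu]
  have hpos : 0 < s * t := by positivity
  refine Nat.eq_of_mul_eq_mul_left hpos ?_
  zify at *
  linear_combination (-p * u) * h₄ + (r * u) * h₃ + (1 + w) * (z * s) * h₅

lemma succ_mul_le_four_mul {w v : ℕ} (h : 1 < v * w) : (1 + w) * v ≤ 4 * (v * w - 1) := by
  obtain ⟨p, hp⟩ : ∃ p, v * w = p + 2 := ⟨v * w - 2, by omega⟩
  have hv : 0 < v := Nat.pos_of_ne_zero (by rintro rfl; simp at h)
  have hw : 0 < w := Nat.pos_of_ne_zero (by rintro rfl; simp at h)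
  have : v ≤ v * w := Nat.le_mul_of_pos_right v hw
  have e : (1 + w) * v = v + v * w := by ring
  omega

lemma FiveTermRel.symm {v w x y z : ℕ} (h : FiveTermRel v w x y z) : FiveTermRel z y x w v := by
  unfold FiveTermRel at *
  rw [mul_comm z y, mul_comm w v, mul_comm (y * z - 1), h]
  ring

lemma FiveTermRel.le {v w x y z : ℕ} (h : FiveTermRel v w x y z) (h₂ : 1 < y * z) :
    (1 + x) * (v * w - 1) ≤ 4 * ((1 + w) * v) := by
  have h₃ : (1 + y) * z ≤ 4 * (y * z - 1) := by
    simpa only [Nat.mul_comm z y] using succ_mul_le_four_mul (w := y) (v := z) (by rwa [mul_comm])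
  have hpos : 0 < y * z - 1 := by omega
  refine Nat.le_of_mul_le_mul_left ?_ hpos
  unfold FiveTermRel at h
  calc (y * z - 1) * ((1 + x) * (v * w - 1))
      = (v * w - 1) * (y * z - 1) * (1 + x) := by ring
    _ = ((1 + w) * v) * ((1 + y) * z) := by rw [h]; ring
    _ ≤ ((1 + w) * v) * (4 * (y * z - 1)) := Nat.mul_le_mul_left _ h₃
    _ = (y * z - 1) * (4 * ((1 + w) * v)) := by ring

lemma FiveTermRel.growthBound {t u v w x y z : ℕ} (h : FiveTermRel v w x y z)
    (h' : FiveTermRel t u v w x) (h₁ : 1 < v * w) (h₂ : 1 < w * x) (h₃ : 1 < y * z)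
    (h₄ : 1 < t * u) : GrowthBound v w x := by
  refine ⟨h₁, h₂, h.le h₃, ?_⟩
  rw [mul_comm] at h₄
  simpa only [mul_comm x w] using h'.symm.le h₄

lemma GrowthBound.lt {v w x : ℕ} (h : GrowthBound v w x) : x < 16 := by
  obtain ⟨h₁, -, h₂, -⟩ := h
  have h₃ := succ_mul_le_four_mul h₁
  have hpos : 0 < v * w - 1 := by omega
  have : 1 + x ≤ 16 := Nat.le_of_mul_le_mul_right (by omega) hpos
  omega

/-- A search over bounded first rows, pruned by the growth estimates. -/
lemma mem_firstRows_of_bounded :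
    ∀ a e i : Fin 16, GrowthBound a e i → ∀ l : Fin 16, GrowthBound e i l →
      ∀ n : Fin 16, GrowthBound i l n → FiveTermRel a e i l n →
      ∀ d : Fin 16, GrowthBound l n d → FiveTermRel e i l n d →
      ∀ h : Fin 16, GrowthBound n d h → FiveTermRel i l n d h →
      FiveTermRel l n d h a → FiveTermRel n d h a e →
      ((a, e, i, l, n, d, h) : ℕ × ℕ × ℕ × ℕ × ℕ × ℕ × ℕ) ∈ yfriezeFirstRows := by
  decide +kernel

/-- Theorem: the 42 arithmetic Y-frieze patterns of width 4. -/
theorem yfrieze4_classification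
    (a b c d e f g h i j k l m n : ℕ) :
    (0 < a ∧ 0 < b ∧ 0 < c ∧ 0 < d ∧ 0 < e ∧ 0 < f ∧ 0 < g ∧
      0 < h ∧ 0 < i ∧ 0 < j ∧ 0 < k ∧ 0 < l ∧ 0 < m ∧ 0 < n ∧
      a * e = 1 + b ∧ b * f = (1 + e) * (1 + c) ∧
      c * g = (1 + f) * (1 + d) ∧ d * h = 1 + g ∧ e * i = 1 + f ∧
      f * j = (1 + i) * (1 + g) ∧ g * k = (1 + j) * (1 + h) ∧
      i * l = 1 + j ∧ j * m = (1 + l) * (1 + k) ∧ l * n = 1 + m) ↔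
    ((a, b, c, d, e, f, g, h, i, j, k, l, m, n) = (1, 1, 2, 3, 2, 9, 20, 7, 5, 14, 6, 3, 2, 1) ∨
    (a, b, c, d, e, f, g, h, i, j, k, l, m, n) = (1, 1, 4, 5, 2, 15, 24, 5, 8, 15, 4, 2, 1, 1) ∨
    (a, b, c, d, e, f, g, h, i, j, k, l, m, n) = (1, 2, 3, 2, 3, 8, 9, 5, 3, 5, 4, 2, 3, 2) ∨
    (a, b, c, d, e, f, g, h, i, j, k, l, m, n) = (1, 2, 3, 4, 3, 8, 15, 4, 3, 8, 3, 3, 2, 1) ∨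
    (a, b, c, d, e, f, g, h, i, j, k, l, m, n) = (1, 2, 6, 7, 3, 14, 20, 3, 5, 9, 2, 2, 1, 1) ∨
    (a, b, c, d, e, f, g, h, i, j, k, l, m, n) = (1, 2, 9, 5, 3, 20, 14, 3, 7, 6, 2, 1, 1, 2) ∨
    (a, b, c, d, e, f, g, h, i, j, k, l, m, n) = (1, 3, 8, 3, 4, 15, 8, 3, 4, 3, 2, 1, 2, 3) ∨
    (a, b, c, d, e, f, g, h, i, j, k, l, m, n) = (1, 4, 5, 3, 5, 9, 8, 3, 2, 3, 2, 2, 3, 2) ∨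
    (a, b, c, d, e, f, g, h, i, j, k, l, m, n) = (1, 4, 15, 8, 5, 24, 15, 2, 5, 4, 1, 1, 1, 2) ∨
    (a, b, c, d, e, f, g, h, i, j, k, l, m, n) = (1, 6, 14, 5, 7, 20, 9, 2, 3, 2, 1, 1, 2, 3) ∨
    (a, b, c, d, e, f, g, h, i, j, k, l, m, n) = (2, 1, 1, 2, 1, 4, 15, 8, 5, 24, 15, 5, 4, 1) ∨
    (a, b, c, d, e, f, g, h, i, j, k, l, m, n) = (2, 1, 2, 3, 1, 6, 14, 5, 7, 20, 9, 3, 2, 1) ∨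
    (a, b, c, d, e, f, g, h, i, j, k, l, m, n) = (2, 3, 2, 1, 2, 3, 4, 5, 2, 5, 9, 3, 8, 3) ∨
    (a, b, c, d, e, f, g, h, i, j, k, l, m, n) = (2, 3, 2, 3, 2, 3, 8, 3, 2, 9, 5, 5, 4, 1) ∨
    (a, b, c, d, e, f, g, h, i, j, k, l, m, n) = (2, 3, 4, 5, 2, 5, 9, 2, 3, 8, 3, 3, 2, 1) ∨
    (a, b, c, d, e, f, g, h, i, j, k, l, m, n) = (2, 3, 8, 3, 2, 9, 5, 2, 5, 4, 3, 1, 2, 3) ∨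
    (a, b, c, d, e, f, g, h, i, j, k, l, m, n) = (2, 5, 9, 2, 3, 8, 3, 2, 3, 2, 3, 1, 4, 5) ∨
    (a, b, c, d, e, f, g, h, i, j, k, l, m, n) = (2, 9, 5, 2, 5, 4, 3, 2, 1, 2, 3, 3, 8, 3) ∨
    (a, b, c, d, e, f, g, h, i, j, k, l, m, n) = (2, 9, 20, 7, 5, 14, 6, 1, 3, 2, 1, 1, 2, 3) ∨
    (a, b, c, d, e, f, g, h, i, j, k, l, m, n) = (2, 15, 24, 5, 8, 15, 4, 1, 2, 1, 1, 1, 4, 5) ∨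
    (a, b, c, d, e, f, g, h, i, j, k, l, m, n) = (3, 2, 1, 1, 1, 2, 6, 7, 3, 14, 20, 5, 9, 2) ∨
    (a, b, c, d, e, f, g, h, i, j, k, l, m, n) = (3, 2, 1, 2, 1, 2, 9, 5, 3, 20, 14, 7, 6, 1) ∨
    (a, b, c, d, e, f, g, h, i, j, k, l, m, n) = (3, 2, 2, 3, 1, 3, 8, 3, 4, 15, 8, 4, 3, 1) ∨
    (a, b, c, d, e, f, g, h, i, j, k, l, m, n) = (3, 2, 3, 2, 1, 4, 5, 3, 5, 9, 8, 2, 3, 2) ∨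
    (a, b, c, d, e, f, g, h, i, j, k, l, m, n) = (3, 5, 4, 1, 2, 3, 2, 3, 2, 3, 8, 2, 9, 5) ∨
    (a, b, c, d, e, f, g, h, i, j, k, l, m, n) = (3, 8, 3, 1, 3, 2, 2, 3, 1, 3, 8, 4, 15, 4) ∨
    (a, b, c, d, e, f, g, h, i, j, k, l, m, n) = (3, 8, 3, 2, 3, 2, 3, 2, 1, 4, 5, 5, 9, 2) ∨
    (a, b, c, d, e, f, g, h, i, j, k, l, m, n) = (3, 8, 9, 5, 3, 5, 4, 1, 2, 3, 2, 2, 3, 2) ∨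
    (a, b, c, d, e, f, g, h, i, j, k, l, m, n) = (3, 8, 15, 4, 3, 8, 3, 1, 3, 2, 2, 1, 3, 4) ∨
    (a, b, c, d, e, f, g, h, i, j, k, l, m, n) = (3, 14, 20, 3, 5, 9, 2, 1, 2, 1, 2, 1, 6, 7) ∨
    (a, b, c, d, e, f, g, h, i, j, k, l, m, n) = (3, 20, 14, 3, 7, 6, 2, 1, 1, 1, 2, 2, 9, 5) ∨
    (a, b, c, d, e, f, g, h, i, j, k, l, m, n) = (4, 3, 2, 1, 1, 2, 3, 4, 3, 8, 15, 3, 8, 3) ∨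
    (a, b, c, d, e, f, g, h, i, j, k, l, m, n) = (4, 15, 8, 3, 4, 3, 2, 1, 1, 2, 3, 3, 8, 3) ∨
    (a, b, c, d, e, f, g, h, i, j, k, l, m, n) = (5, 4, 1, 1, 1, 1, 4, 5, 2, 15, 24, 8, 15, 2) ∨
    (a, b, c, d, e, f, g, h, i, j, k, l, m, n) = (5, 4, 3, 2, 1, 2, 3, 2, 3, 8, 9, 3, 5, 2) ∨
    (a, b, c, d, e, f, g, h, i, j, k, l, m, n) = (5, 9, 2, 1, 2, 1, 2, 3, 1, 6, 14, 7, 20, 3) ∨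
    (a, b, c, d, e, f, g, h, i, j, k, l, m, n) = (5, 9, 8, 3, 2, 3, 2, 1, 2, 3, 4, 2, 5, 3) ∨
    (a, b, c, d, e, f, g, h, i, j, k, l, m, n) = (5, 14, 6, 1, 3, 2, 1, 2, 1, 2, 9, 3, 20, 7) ∨
    (a, b, c, d, e, f, g, h, i, j, k, l, m, n) = (5, 24, 15, 2, 5, 4, 1, 1, 1, 1, 4, 2, 15, 8) ∨
    (a, b, c, d, e, f, g, h, i, j, k, l, m, n) = (7, 6, 2, 1, 1, 1, 2, 3, 2, 9, 20, 5, 14, 3) ∨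
    (a, b, c, d, e, f, g, h, i, j, k, l, m, n) = (7, 20, 9, 2, 3, 2, 1, 1, 1, 2, 6, 3, 14, 5) ∨
    (a, b, c, d, e, f, g, h, i, j, k, l, m, n) = (8, 15, 4, 1, 2, 1, 1, 2, 1, 4, 15, 5, 24, 5)) := by
  constructor
  · rintro ⟨ha, hb, hc, hd, he, hf, hg, hh, hi, hj, hk, hl, hm, hn,
      h₁, h₂, h₃, h₄, h₅, h₆, h₇, h₈, h₉, h₁₀⟩
    have hnd : n * d = 1 + c := glide_diamond hg hj hl h₃ h₄ h₆ h₇ h₈ h₉ h₁₀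
    have hha : h * a = 1 + k := by
      rw [mul_comm]
      exact glide_diamond (c := k) (d := h) (f := j) (g := g) (h := d) (i := i) (j := f)
        (k := c) (l := e) (m := b) (n := a) hg hf he (by linarith) (by linarith)
        (by linarith) (by linarith) (by linarith) (by linarith) (by linarith)
    have hmc : m * c = (1 + n) * (1 + b) := closing_diamond hd hg hj h₃ h₄ h₅ h₆ h₈ h₉ hnd hha h₁
    have hkb : k * b = (1 + a) * (1 + m) := by
      rw [mul_comm]
      exact closing_diamond (a := n) (b := m) (c := k) (d := h) (e := l) (f := j) (g := g) (h := d)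
        (i := i) (j := f) (k := c) (l := e) (m := b) (n := a) hh hg hf (by linarith) (by linarith)
        (by linarith) (by linarith) (by linarith) (by linarith) (by linarith) (by linarith)
        (by linarith)
    rw [← hnd] at h₂
    rw [← h₅, mul_comm (e * i)] at h₃
    rw [← h₄] at h₆
    rw [← h₈, mul_comm (i * l)] at h₇
    rw [← hha] at h₉
    rw [← h₁] at hmc
    rw [← h₁₀] at hkb
    have ri : FiveTermRel a e i l n :=
      fiveTermRel_of_diamonds hd hh h₁ h₁₀ h₂ h₆ h₉
    have rl : FiveTermRel e i l n d :=
      fiveTermRel_of_diamonds hh ha h₅ hnd h₆ h₉ hmc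
    have rn : FiveTermRel i l n d h :=
      fiveTermRel_of_diamonds ha he h₈ h₄ h₉ hmc h₃
    have rd : FiveTermRel l n d h a :=
      fiveTermRel_of_diamonds he hi h₁₀ hha hmc h₃ h₇
    have rh : FiveTermRel n d h a e :=
      fiveTermRel_of_diamonds hi hl hnd h₁ h₃ h₇ hkb
    have ra : FiveTermRel d h a e i :=
      fiveTermRel_of_diamonds hl hn h₄ h₅ h₇ hkb h₂
    have re : FiveTermRel h a e i l :=
      fiveTermRel_of_diamonds hn hd hha h₈ hkb h₂ h₆
    have bi := ri.growthBound ra (by omega) (by omega) (by omega) (by omega)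
    have bl := rl.growthBound re (by omega) (by omega) (by omega) (by omega)
    have bn := rn.growthBound ri (by omega) (by omega) (by omega) (by omega)
    have bd := rd.growthBound rl (by omega) (by omega) (by omega) (by omega)
    have bh := rh.growthBound rn (by omega) (by omega) (by omega) (by omega)
    have ba := ra.growthBound rd (by omega) (by omega) (by omega) (by omega)
    have be := re.growthBound rh (by omega) (by omega) (by omega) (by omega)
    have hmem := mem_firstRows_of_bounded ⟨a, ba.lt⟩ ⟨e, be.lt⟩ ⟨i, bi.lt⟩ bi ⟨l, bl.lt⟩ bl
      ⟨n, bn.lt⟩ bn ri ⟨d, bd.lt⟩ bd rl ⟨h, bh.lt⟩ bh rn rd rh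
    obtain rfl : b = a * e - 1 := by omega
    obtain rfl : c = n * d - 1 := by omega
    obtain rfl : f = e * i - 1 := by omega
    obtain rfl : g = d * h - 1 := by omega
    obtain rfl : j = i * l - 1 := by omega
    obtain rfl : k = h * a - 1 := by omega
    obtain rfl : m = l * n - 1 := by omega
    clear * - hmem
    revert hmem
    simp only [yfriezeFirstRows, List.mem_cons, List.not_mem_nil, or_false, Prod.mk.injEq]
    repeat' apply Or.imp
    all_goals
      rintro ⟨rfl, rfl, rfl, rfl, rfl, rfl, rfl⟩
      decide
  · simp only [Prod.mk.injEq]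
    repeat' refine or_imp.mpr ⟨?_, ?_⟩
    all_goals
      rintro ⟨rfl, rfl, rfl, rfl, rfl, rfl, rfl, rfl, rfl, rfl, rfl, rfl, rfl, rfl⟩
      decide
end
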